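/- arXiv:1911.11852 — 2 statements merged into one kernel-verified Lean document; each statement's English description precedes it below -/
import Mathlib

section
/- Define V : ℝ → ℝ by V(x) = (3x² − x·((1−x)/2) + 11·((1−x)/2)²)/(x·(1−x)) (equivalently V(x) = (25x² − 24x + 11)/(4x(1−x))). Then for all x in the open interval (0,1), V(x) ≥ V(2√33 − 11), with equality if and only if x = 2√33 − 11; i.e., V attains its unique minimum on (0,1) at x = 2√33 − 11 ≈ 0.489. -/
/-- The normalized two-queue waiting-time variance as a function of x = λ₁. -/
noncomputable def V (x : ℝ) : ℝ :=
  (3 * x ^ 2 - x * ((1 - x) / 2) + 11 * ((1 - x) / 2) ^ 2) / (x * (1 - x))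

/-- V attains its unique minimum on (0,1) at x = 2√33 − 11. -/
theorem two_queue_variance_min :
    ∀ x : ℝ, 0 < x → x < 1 →
      V x ≥ V (2 * Real.sqrt 33 - 11) ∧
      (V x = V (2 * Real.sqrt 33 - 11) ↔ x = 2 * Real.sqrt 33 - 11) := by
  have hs : Real.sqrt 33 ^ 2 = 33 := Real.sq_sqrt (by norm_num)
  have hs0 : 0 ≤ Real.sqrt 33 := Real.sqrt_nonneg _
  generalize Real.sqrt 33 = s at hs hs0 ⊢
  have h1 : 5.5 < s := by nlinarith
  have h2 : s < 6 := by nlinarith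
  have key : ∀ x : ℝ, 0 < x → x < 1 →
      V x = s - 1 / 2 + (23 + 4 * s) * (x - (2 * s - 11)) ^ 2 / (4 * (x * (1 - x))) := by
    intro x hx hx1
    have hx' : x ≠ 0 := hx.ne'
    have hy' : 1 - x ≠ 0 := by linarith
    have e : (23 + 4 * s) * (x - (2 * s - 11)) ^ 2
        = 12 * x ^ 2 - 4 * s * (x * (1 - x)) + 11 * (1 - x) ^ 2 := by
      linear_combination (16 * s - 16 * x - 84) * hs
    rw [e, V]
    field_simp
    ring
  have h0 : V (2 * s - 11) = s - 1 / 2 := by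
    rw [key _ (by linarith) (by linarith)]
    simp
  intro x hx hx1
  have hp : 0 < x * (1 - x) := mul_pos hx (by linarith)
  rw [h0, key x hx hx1]
  refine ⟨?_, ?_, ?_⟩
  · have : 0 ≤ (23 + 4 * s) * (x - (2 * s - 11)) ^ 2 / (4 * (x * (1 - x))) := by positivity
    linarith
  · intro h
    by_contra hne
    have hne' : x - (2 * s - 11) ≠ 0 := sub_ne_zero.mpr hne
    have : 0 < (23 + 4 * s) * (x - (2 * s - 11)) ^ 2 / (4 * (x * (1 - x))) := by positivity
    linarith
  · intro h
    have : x - (2 * s - 11) = 0 := by linarith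
    rw [this]
    simp
end

section
/- Let λ_A, λ_B, λ_C > 0 with λ_C > |λ_A − λ_B|, set λ_total = λ_A + λ_B + λ_C, and define π₀ = (λ_A/(λ_B + λ_C − λ_A) + λ_B/(λ_A + λ_C − λ_B) + λ_C/λ_total + 1)⁻¹, E[T_A] = (λ_B + λ_C)·π₀/(λ_B + λ_C − λ_A)², E[T_B] = (λ_A + λ_C)·π₀/(λ_A + λ_C − λ_B)², and E[T_C] = π₀/λ_total. Then the overall expected waiting time (λ_A·E[T_A] + λ_B·E[T_B] + λ_C·E[T_C])/λ_total equals 1/(2(λ_A + λ_C − λ_B)) + 1/(2(λ_B + λ_C − λ_A)) + 1/(λ_A + λ_B + λ_C) − 1/(2λ_C) − (λ_A + λ_B + 2λ_C)/(2(2λ_Aλ_B + λ_Aλ_C + λ_Bλ_C + λ_C²)). -/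
/-- Overall expected waiting time in the side-selection model. -/
theorem side_selection_overall_ET
    (lamA lamB lamC : ℝ) (hA : 0 < lamA) (hB : 0 < lamB) (hC : 0 < lamC)
    (hrec : lamC > |lamA - lamB|)
    (lamTotal : ℝ) (hTotal : lamTotal = lamA + lamB + lamC)
    (pi0 : ℝ)
    (hpi0 : pi0 = (lamA / (lamB + lamC - lamA) + lamB / (lamA + lamC - lamB) +
        lamC / lamTotal + 1)⁻¹)
    (ETA ETB ETC : ℝ)
    (hETA : ETA = (lamB + lamC) * pi0 / (lamB + lamC - lamA) ^ 2)
    (hETB : ETB = (lamA + lamC) * pi0 / (lamA + lamC - lamB) ^ 2)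
    (hETC : ETC = pi0 / lamTotal) :
    (lamA * ETA + lamB * ETB + lamC * ETC) / lamTotal
      = 1 / (2 * (lamA + lamC - lamB)) + 1 / (2 * (lamB + lamC - lamA)) +
        1 / (lamA + lamB + lamC) - 1 / (2 * lamC) -
        (lamA + lamB + 2 * lamC) /
          (2 * (2 * lamA * lamB + lamA * lamC + lamB * lamC + lamC ^ 2)) := by
  have h := abs_lt.mp hrec
  have hp : 0 < lamB + lamC - lamA := by linarith [h.2]
  have hq : 0 < lamA + lamC - lamB := by linarith [h.1]
  have hT : 0 < lamA + lamB + lamC := by positivity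
  have hD : 0 < 2 * lamA * lamB + lamA * lamC + lamB * lamC + lamC ^ 2 := by positivity
  have hpi : pi0 = (lamB + lamC - lamA) * (lamA + lamC - lamB) * (lamA + lamB + lamC) /
      (2 * lamC * (2 * lamA * lamB + lamA * lamC + lamB * lamC + lamC ^ 2)) := by
    rw [hpi0, hTotal, inv_eq_iff_eq_inv, inv_div]
    have := hp.ne'
    have := hq.ne'
    have := hT.ne'
    field_simp
    ring
  have := hp.ne'
  have := hq.ne'
  have := hT.ne'
  have := hD.ne'
  rw [hETA, hETB, hETC, hpi, hTotal]
  clear hpi hpi0 hETA hETB hETC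
  generalize hDD : 2 * lamA * lamB + lamA * lamC + lamB * lamC + lamC ^ 2 = D at *
  field_simp
  rw [← hDD]
  ring
end
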